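/- (Existence of attracting weak chimeras in the four-oscillator network.) Let g(φ) = −sin(φ − α) + r·sin(2φ) with r < −|cos α|/2 and sin α ≠ 0. Then there exists ε_0 > 0 such that for every ε with |ε| < ε_0 the reduced four-oscillator system φ̇_1 = q(φ_1) + ε(g(φ_3) + g(φ_3+φ_2) − g(φ_3−φ_1) − g(φ_2+φ_3−φ_1)), φ̇_2 = q(φ_2) + ε(g(−φ_3) + g(φ_1−φ_3) − g(−φ_2−φ_3) − g(φ_1−φ_2−φ_3)), φ̇_3 = g(φ_1) − g(φ_2) + ε(g(φ_3) + g(φ_3+φ_2) − g(−φ_3) − g(φ_1−φ_3)) has a solution φ : ℝ → ℝ^3 and a period T > 0 with φ_1(t+T) = φ_1(t), φ_2(t+T) = φ_2(t), and φ_3(t+T) = φ_3(t) + 2πσ for all t and some σ ∈ {+1, −1}; this orbit is asymptotically stable in the sense that there is δ > 0 such that every solution ψ with dist(ψ(0), Γ) < δ satisfies dist(ψ(t), Γ) → 0 as t → ∞, where Γ := {φ(s) + 2πk : s ∈ ℝ, k ∈ ℤ^3}; moreover along φ one has φ_1, φ_2 bounded and lim_{t→∞} φ_3(t)/t = 2πσ/T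 ≠ 0 (so the corresponding four oscillators satisfy Ω_{13} = Ω_{24} = 0 and Ω_{12} ≠ 0, a weak chimera). -/

import Mathlib

lemma wc_kernel_bound (l D : ℝ) (hl : 0 < l) (f : ℝ → ℝ)
    (hD : ∀ r, |f r| ≤ D) :
    |(1 - Real.exp (-l * (2 * Real.pi)))⁻¹ * ∫ r in (0:ℝ)..(2 * Real.pi), Real.exp (-l * r) * f r|
      ≤ D / l := by
  have hpi : 0 < 2 * Real.pi := by positivity
  have hk : 0 < 1 - Real.exp (-l * (2 * Real.pi)) := by
    have : Real.exp (-l * (2 * Real.pi)) < 1 := by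
      rw [Real.exp_lt_one_iff]; nlinarith
    linarith
  have hint : ∫ r in (0:ℝ)..(2 * Real.pi), Real.exp (-l * r) * D
      = (1 - Real.exp (-l * (2 * Real.pi))) * (D / l) := by
    have hd : ∀ x ∈ Set.uIcc (0:ℝ) (2 * Real.pi),
        HasDerivAt (fun r => -(Real.exp (-l * r) * (D / l))) (Real.exp (-l * x) * D) x := by
      intro x _
      have h1 : HasDerivAt (fun r : ℝ => -l * r) (-l) x := by
        simpa using (hasDerivAt_id x).const_mul (-l)
      have h2 := ((h1.exp).mul_const (D / l)).neg
      have e : Real.exp (-l * x) * D = -(Real.exp (-l * x) * -l * (D / l)) := by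
        field_simp
      rw [e]
      exact h2
    rw [intervalIntegral.integral_eq_sub_of_hasDerivAt hd
      ((by fun_prop : Continuous fun r => Real.exp (-l * r) * D).intervalIntegrable _ _)]
    simp
    ring
  have hle : |∫ r in (0:ℝ)..(2 * Real.pi), Real.exp (-l * r) * f r|
      ≤ ∫ r in (0:ℝ)..(2 * Real.pi), Real.exp (-l * r) * D := by
    rw [← Real.norm_eq_abs]
    apply intervalIntegral.norm_integral_le_of_norm_le hpi.le
    · refine Filter.Eventually.of_forall fun r _ => ?_
      rw [Real.norm_eq_abs, abs_mul, abs_of_pos (Real.exp_pos _)]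
      exact mul_le_mul_of_nonneg_left (hD r) (Real.exp_pos _).le
    · exact (by fun_prop : Continuous fun r => Real.exp (-l * r) * D).intervalIntegrable _ _
  rw [abs_mul, abs_of_pos (inv_pos.2 hk)]
  rw [hint] at hle
  calc _ ≤ (1 - Real.exp (-l * (2 * Real.pi)))⁻¹ * ((1 - Real.exp (-l * (2 * Real.pi))) * (D / l)) :=
        mul_le_mul_of_nonneg_left hle (inv_pos.2 hk).le
    _ = D / l := by rw [← mul_assoc, inv_mul_cancel₀ hk.ne', one_mul]

lemma wc_periodic_sol (l L B : ℝ) (hl : 0 < l) (hL : 0 ≤ L) (hLl : L < l) (N : ℝ → ℝ → ℝ)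
    (hc : Continuous (Function.uncurry N)) (hper : ∀ s y, N (s + 2 * Real.pi) y = N s y)
    (hlip : ∀ s y y', |N s y - N s y'| ≤ L * |y - y'|) (hB : ∀ s y, |N s y| ≤ B) :
    ∃ v : ℝ → ℝ, (∀ s, HasDerivAt v (-l * v s + N s (v s)) s) ∧
      (∀ s, v (s + 2 * Real.pi) = v s) ∧ ∀ s, |v s| ≤ B / l := by
  have hpi : 0 < 2 * Real.pi := by positivity
  have hk : 0 < 1 - Real.exp (-l * (2 * Real.pi)) := by
    have : Real.exp (-l * (2 * Real.pi)) < 1 := by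
      rw [Real.exp_lt_one_iff]; nlinarith
    linarith
  set k := (1 - Real.exp (-l * (2 * Real.pi)))⁻¹ with hkdef
  have hNc : ∀ y : ℝ → ℝ, Continuous y → Continuous fun s => N s (y s) := fun y hy =>
    hc.comp (continuous_id.prodMk hy)
  have hcont : ∀ y : BoundedContinuousFunction ℝ ℝ, Continuous fun s : ℝ =>
      k * ∫ r in (0:ℝ)..(2 * Real.pi), Real.exp (-l * r) * N (s - r) (y (s - r)) := by
    intro y
    refine continuous_const.mul ?_
    apply intervalIntegral.continuous_parametric_intervalIntegral_of_continuous' (μ := MeasureTheory.volume)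
      (f := fun s r => Real.exp (-l * r) * N (s - r) (y (s - r)))
    have := (hNc y y.continuous).comp (continuous_fst.sub continuous_snd : Continuous fun p : ℝ × ℝ => p.1 - p.2)
    exact (by fun_prop : Continuous fun p : ℝ × ℝ => Real.exp (-l * p.2)).mul this
  let K : BoundedContinuousFunction ℝ ℝ → BoundedContinuousFunction ℝ ℝ := fun y =>
    BoundedContinuousFunction.ofNormedAddCommGroup _ (hcont y) (B / l)
      (fun s => wc_kernel_bound l B hl _ (fun r => hB _ _))
  have hK : ∀ y s, K y s = k * ∫ r in (0:ℝ)..(2 * Real.pi),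
      Real.exp (-l * r) * N (s - r) (y (s - r)) := fun y s => rfl
  have hcontr : ContractingWith (Real.toNNReal (L / l)) K := by
    constructor
    · rw [Real.toNNReal_lt_one]
      exact (div_lt_one hl).2 hLl
    · apply LipschitzWith.of_dist_le_mul
      intro y z
      rw [Real.coe_toNNReal _ (by positivity)]
      rw [BoundedContinuousFunction.dist_le (by positivity)]
      intro s
      rw [Real.dist_eq, hK, hK, ← mul_sub, ← intervalIntegral.integral_sub]
      · have := wc_kernel_bound l (L * dist y z) hl
          (fun r => N (s - r) (y (s - r)) - N (s - r) (z (s - r))) (fun r =>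
            (hlip _ _ _).trans (mul_le_mul_of_nonneg_left
              ((Real.dist_eq _ _).symm.le.trans (BoundedContinuousFunction.dist_coe_le_dist _)) hL))
        simp only [← mul_sub]
        refine this.trans (le_of_eq ?_)
        show _ = L / l * dist y z
        ring
      · exact ((by fun_prop : Continuous fun r => Real.exp (-l * r)).mul
          ((hNc y y.continuous).comp (continuous_const.sub continuous_id))).intervalIntegrable _ _
      · exact ((by fun_prop : Continuous fun r => Real.exp (-l * r)).mul
          ((hNc z z.continuous).comp (continuous_const.sub continuous_id))).intervalIntegrable _ _
  obtain ⟨v, hv⟩ : ∃ v, Function.IsFixedPt K v := ⟨_, hcontr.fixedPoint_isFixedPt⟩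
  have hvs : ∀ s, v s = k * ∫ r in (0:ℝ)..(2 * Real.pi),
      Real.exp (-l * r) * N (s - r) (v (s - r)) := fun s => by
    conv_lhs => rw [← hv]
    exact hK v s
  have hvper : ∀ s, v (s + 2 * Real.pi) = v s := by
    let w : BoundedContinuousFunction ℝ ℝ :=
      v.compContinuous ⟨fun s => s + 2 * Real.pi, by fun_prop⟩
    have hw : ∀ s, w s = v (s + 2 * Real.pi) := fun s => rfl
    have hwf : Function.IsFixedPt K w := by
      ext s
      rw [hK, hw, hvs]
      congr 2
      ext r
      rw [hw, show s + 2 * Real.pi - r = (s - r) + 2 * Real.pi by ring, hper]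
    have := hcontr.fixedPoint_unique' hwf hv
    intro s
    rw [← hw, this]
  refine ⟨v, ?_, hvper, fun s => ?_⟩
  · set f : ℝ → ℝ := fun s => N s (v s) with hf
    have hfc : Continuous f := hNc v v.continuous
    have hfp : ∀ s, f (s - 2 * Real.pi) = f s := by
      intro s
      have h1 := hvper (s - 2 * Real.pi)
      have h2 := hper (s - 2 * Real.pi) (v s)
      simp only [sub_add_cancel] at h1 h2
      simp only [hf]
      rw [← h1, ← h2]
    set P : ℝ → ℝ := fun s => ∫ u in (0:ℝ)..s, Real.exp (l * u) * f u with hP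
    have hgc : Continuous fun u => Real.exp (l * u) * f u := by fun_prop
    have hPd : ∀ s, HasDerivAt P (Real.exp (l * s) * f s) s := fun s =>
      hgc.integral_hasStrictDerivAt 0 s |>.hasDerivAt
    have hv2 : ∀ s, v s = k * (Real.exp (-l * s) * (P s - P (s - 2 * Real.pi))) := by
      intro s
      rw [hvs s]
      congr 1
      have h1 : P s - P (s - 2 * Real.pi) = ∫ u in (s - 2 * Real.pi)..s, Real.exp (l * u) * f u := by
        rw [hP]
        exact intervalIntegral.integral_interval_sub_left (hgc.intervalIntegrable _ _) (hgc.intervalIntegrable _ _)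
      rw [h1, ← intervalIntegral.integral_const_mul]
      have h2 := intervalIntegral.integral_comp_sub_left (a := 0) (b := 2 * Real.pi)
        (fun u => Real.exp (-l * s) * (Real.exp (l * u) * f u)) s
      simp only [sub_zero] at h2
      rw [← h2]
      congr 1
      ext r
      rw [← mul_assoc, ← Real.exp_add]
      congr 2
      ring
    intro s
    have hvf : (v : ℝ → ℝ) = fun s => k * (Real.exp (-l * s) * (P s - P (s - 2 * Real.pi))) :=
      funext hv2
    have hd1 : HasDerivAt (fun s : ℝ => Real.exp (-l * s)) (Real.exp (-l * s) * -l) s := by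
      have h1 : HasDerivAt (fun r : ℝ => -l * r) (-l) s := by
        simpa using (hasDerivAt_id s).const_mul (-l)
      exact h1.exp
    have hd2 : HasDerivAt (fun s => P (s - 2 * Real.pi))
        (Real.exp (l * (s - 2 * Real.pi)) * f (s - 2 * Real.pi)) s :=
      (hPd (s - 2 * Real.pi)).comp_sub_const s (2 * Real.pi)
    have hd := (hd1.mul ((hPd s).sub hd2)).const_mul k
    have : -l * v s + N s (v s) = k * (Real.exp (-l * s) * -l * (P s - P (s - 2 * Real.pi)) +
        Real.exp (-l * s) * (Real.exp (l * s) * f s -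
          Real.exp (l * (s - 2 * Real.pi)) * f (s - 2 * Real.pi))) := by
      rw [hfp, hv2 s]
      have e1 : Real.exp (-l * s) * Real.exp (l * s) = 1 := by
        rw [← Real.exp_add]; simp
      have e2 : Real.exp (-l * s) * Real.exp (l * (s - 2 * Real.pi)) = Real.exp (-l * (2 * Real.pi)) := by
        rw [← Real.exp_add]; congr 1; ring
      have e3 : k * (1 - Real.exp (-l * (2 * Real.pi))) = 1 := inv_mul_cancel₀ hk.ne'
      have e4 : N s (k * (Real.exp (-l * s) * (P s - P (s - 2 * Real.pi)))) = f s := by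
        rw [← hv2 s]
      rw [e4]
      linear_combination (-f s) * e3 - k * f s * e1 + k * f s * e2
    rw [this]
    rw [hvf]
    exact hd
  · rw [hvs]
    exact wc_kernel_bound l B hl _ (fun r => hB _ _)

lemma wc_time_param (H : ℝ → ℝ) (m M : ℝ) (hm : 0 < m) (hc : Continuous H)
    (hper : ∀ s, H (s + 2 * Real.pi) = H s) (h1 : ∀ s, m ≤ H s) (h2 : ∀ s, H s ≤ M) :
    ∃ (S : ℝ → ℝ) (T : ℝ), 0 < T ∧ (∀ t, HasDerivAt S (H (S t)) t) ∧
      (∀ t, S (t + T) = S t + 2 * Real.pi) ∧ Function.Surjective S := by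
  have hpos : ∀ s, 0 < H s := fun s => hm.trans_le (h1 s)
  have hM : 0 < M := (hpos 0).trans_le (h2 0)
  have hic : Continuous fun s => (H s)⁻¹ := hc.inv₀ fun s => (hpos s).ne'
  set G : ℝ → ℝ := fun s => ∫ u in (0:ℝ)..s, (H u)⁻¹ with hG
  have hGd : ∀ s, HasDerivAt G (H s)⁻¹ s := fun s =>
    (hic.integral_hasStrictDerivAt 0 s).hasDerivAt
  have hGc : Continuous G := continuous_iff_continuousAt.2 fun s => (hGd s).continuousAt
  have hGm : StrictMono G := strictMono_of_deriv_pos fun s => by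
    rw [(hGd s).deriv]; exact inv_pos.2 (hpos s)
  have hG0 : G 0 = 0 := by simp [hG]
  have hmono : Monotone fun s => G s - s / M := by
    apply monotone_of_deriv_nonneg
    · intro s
      exact ((hGd s).sub ((hasDerivAt_id s).div_const M)).differentiableAt
    · intro s
      have := ((hGd s).sub ((hasDerivAt_id s).div_const M)).deriv
      have e : deriv (fun s => G s - s / M) s = (H s)⁻¹ - 1 / M := this
      rw [e, one_div, sub_nonneg]
      exact inv_anti₀ (hpos s) (h2 s)
  have hsurj : Function.Surjective G := by
    apply hGc.surjective
    · apply Filter.tendsto_atTop_mono' _ _ (Filter.tendsto_id.atTop_div_const hM)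
      filter_upwards [Filter.eventually_ge_atTop 0] with s hs
      have := hmono hs
      simp only [hG0, id] at this ⊢
      simp at this
      linarith
    · apply Filter.tendsto_atBot_mono' _ _ (Filter.tendsto_id.atBot_div_const hM)
      filter_upwards [Filter.eventually_le_atBot 0] with s hs
      have := hmono hs
      simp only [hG0, id] at this ⊢
      simp at this
      linarith
  let e := hGm.orderIsoOfSurjective G hsurj
  have heG : ∀ s, e s = G s := fun s => rfl
  have hGs : ∀ t, G (e.symm t) = t := fun t => e.apply_symm_apply t
  have hadd : ∀ s, G (s + 2 * Real.pi) = G s + G (2 * Real.pi) := by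
    intro s
    have a1 : G (s + 2 * Real.pi) - G s = ∫ u in s..(s + 2 * Real.pi), (H u)⁻¹ :=
      intervalIntegral.integral_interval_sub_left (hic.intervalIntegrable _ _)
        (hic.intervalIntegrable _ _)
    have hp : Function.Periodic (fun u => (H u)⁻¹) (2 * Real.pi) := fun u => by
      simp only [hper]
    have a2 := hp.intervalIntegral_add_eq s 0
    simp only [zero_add] at a2
    have : G (2 * Real.pi) = ∫ u in (0:ℝ)..(2 * Real.pi), (H u)⁻¹ := rfl
    linarith
  refine ⟨e.symm, G (2 * Real.pi), ?_, ?_, ?_, e.symm.surjective⟩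
  · rw [← hG0]; exact hGm (by positivity)
  · intro t
    have := HasDerivAt.of_local_left_inverse (f := G) (g := e.symm) (a := t)
      e.symm.continuous.continuousAt (hGd _) (inv_ne_zero (hpos _).ne')
      (Filter.Eventually.of_forall hGs)
    simpa using this
  · intro t
    apply hGm.injective
    rw [hGs, hadd, hGs]

lemma wc_avg (f : ℝ → ℝ) (T a : ℝ) (hT : 0 < T) (hc : Continuous f)
    (hf : ∀ t, f (t + T) = f t + a) :
    Filter.Tendsto (fun t : ℝ => f t / t) Filter.atTop (nhds (a / T)) := by
  have hp : Function.Periodic (fun t => f t - a / T * t) T := by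
    intro t
    simp only [hf]
    field_simp
    ring
  have hb := hp.isBounded_of_continuous hT.ne' (by fun_prop)
  obtain ⟨C, hC⟩ := hb.exists_norm_le
  have h0 : Filter.Tendsto (fun t : ℝ => (f t - a / T * t) / t) Filter.atTop (nhds 0) := by
    have := (Filter.tendsto_id (α := ℝ) (x := Filter.atTop)).const_div_atTop C
    apply squeeze_zero_norm' _ this
    filter_upwards [Filter.eventually_gt_atTop 0] with t ht
    rw [norm_div, Real.norm_of_nonneg ht.le]
    exact div_le_div_of_nonneg_right (hC _ ⟨t, rfl⟩) ht.le
  have h1 := h0.add_const (a / T)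
  rw [zero_add] at h1
  apply h1.congr'
  filter_upwards [Filter.eventually_gt_atTop 0] with t ht
  field_simp
  ring

lemma wc_stab (c M η : ℝ) (hc : 0 < c) (hη : 0 < η) :
    ∃ δ > 0, ∀ x w dx dw : ℝ → ℝ, (∀ t, HasDerivAt x (dx t) t) → (∀ t, HasDerivAt w (dw t) t) →
      (∀ t, |x t| ≤ η → |w t| ≤ η → x t * dx t ≤ -c * x t ^ 2 ∧
        w t * dw t ≤ -c * w t ^ 2 + M * (|x t| * |w t|)) →
      |x 0| ≤ δ → |w 0| ≤ δ →
      Filter.Tendsto (fun t => |x t| + |w t|) Filter.atTop (nhds 0) := by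
  set K := 1 + M ^ 2 / c ^ 2 with hK
  have hK1 : 1 ≤ K := by
    have : 0 ≤ M ^ 2 / c ^ 2 := by positivity
    linarith
  have hKc : K * c = c + M ^ 2 / c := by rw [hK]; field_simp
  refine ⟨η / (1 + K), by positivity, ?_⟩
  intro x w dx dw hx hw hreg hx0 hw0
  have key : ∀ t, 0 ≤ t → w t ^ 2 + K * x t ^ 2 ≤ η ^ 2 * Real.exp (-(c / 2) * t) := by
    intro t ht
    have hVd : ∀ s, HasDerivAt (fun s => w s ^ 2 + K * x s ^ 2)
        (2 * (w s * dw s) + K * (2 * (x s * dx s))) s := by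
      intro s
      have := ((hw s).pow 2).add (((hx s).pow 2).const_mul K)
      have e : 2 * (w s * dw s) + K * (2 * (x s * dx s))
          = ((2 : ℕ) : ℝ) * w s ^ (2 - 1) * dw s + K * (((2 : ℕ) : ℝ) * x s ^ (2 - 1) * dx s) := by
        norm_num
        ring
      rw [e]
      exact this
    have hBd : ∀ s, HasDerivAt (fun s => η ^ 2 * Real.exp (-(c / 2) * s))
        (η ^ 2 * (Real.exp (-(c / 2) * s) * -(c / 2))) s := by
      intro s
      have h1 : HasDerivAt (fun r : ℝ => -(c / 2) * r) (-(c / 2)) s := by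
        simpa using (hasDerivAt_id s).const_mul (-(c / 2))
      exact h1.exp.const_mul _
    refine image_le_of_deriv_right_lt_deriv_boundary (a := 0) (b := t)
      (f := fun s => w s ^ 2 + K * x s ^ 2)
      (fun s _ => (hVd s).continuousAt.continuousWithinAt)
      (fun s _ => (hVd s).hasDerivWithinAt) ?_ hBd ?_ ⟨ht, le_rfl⟩
    · simp only [mul_zero, Real.exp_zero, mul_one]
      have a1 : x 0 ^ 2 ≤ (η / (1 + K)) ^ 2 := sq_le_sq' (abs_le.1 hx0).1 (abs_le.1 hx0).2
      have a2 : w 0 ^ 2 ≤ (η / (1 + K)) ^ 2 := sq_le_sq' (abs_le.1 hw0).1 (abs_le.1 hw0).2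
      calc w 0 ^ 2 + K * x 0 ^ 2 ≤ (η / (1 + K)) ^ 2 + K * (η / (1 + K)) ^ 2 := by gcongr
        _ = η ^ 2 / (1 + K) := by field_simp
        _ ≤ η ^ 2 := div_le_self (by positivity) (by linarith)
    · intro s hs heq
      have hE : Real.exp (-(c / 2) * s) ≤ 1 := by
        rw [Real.exp_le_one_iff]; nlinarith [hs.1]
      have hEp := Real.exp_pos (-(c / 2) * s)
      set E := Real.exp (-(c / 2) * s)
      have heq' : w s ^ 2 + K * x s ^ 2 = η ^ 2 * E := heq
      have hle : w s ^ 2 + K * x s ^ 2 ≤ η ^ 2 := by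
        rw [heq']; exact mul_le_of_le_one_right (by positivity) hE
      have hVp : 0 < w s ^ 2 + K * x s ^ 2 := by rw [heq']; positivity
      have bx : |x s| ≤ η := abs_le_of_sq_le_sq (by nlinarith [sq_nonneg (w s), sq_nonneg (x s)]) hη.le
      have bw : |w s| ≤ η := abs_le_of_sq_le_sq (by nlinarith [sq_nonneg (w s), sq_nonneg (x s)]) hη.le
      obtain ⟨r1, r2⟩ := hreg s bx bw
      have r3 : M * (|x s| * |w s|) ≤ c / 2 * w s ^ 2 + M ^ 2 / c / 2 * x s ^ 2 := by
        have e1 : c / 2 * w s ^ 2 + M ^ 2 / c / 2 * x s ^ 2 - M * (|x s| * |w s|)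
            = (c * |w s| - M * |x s|) ^ 2 / (2 * c) := by
          rw [← sq_abs (w s), ← sq_abs (x s)]
          field_simp
          ring
        have e2 : 0 ≤ (c * |w s| - M * |x s|) ^ 2 / (2 * c) := by positivity
        linarith
      have r4 : K * (2 * (x s * dx s)) ≤ K * (2 * (-c * x s ^ 2)) := by
        gcongr
      have r5 : K * (2 * (-c * x s ^ 2)) = -(c + M ^ 2 / c) * x s ^ 2 - K * c * x s ^ 2 := by
        rw [← hKc]; ring
      have r6 : η ^ 2 * (E * -(c / 2)) = -(c / 2) * (w s ^ 2 + K * x s ^ 2) := by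
        rw [heq']; ring
      rw [r6]
      have r7 : 0 < c / 2 * (w s ^ 2 + K * x s ^ 2) := by positivity
      have r8 : 0 ≤ c * x s ^ 2 := by positivity
      linarith
  have hlim : Filter.Tendsto (fun t : ℝ => 2 * (η * Real.exp (-(c / 4) * t))) Filter.atTop (nhds 0) := by
    have : Filter.Tendsto (fun t : ℝ => Real.exp (-(c / 4) * t)) Filter.atTop (nhds 0) := by
      apply Real.tendsto_exp_atBot.comp
      exact Filter.tendsto_id.const_mul_atTop_of_neg (by linarith)
    simpa using (this.const_mul η).const_mul 2
  apply squeeze_zero' (Filter.Eventually.of_forall fun t => by positivity) _ hlim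
  filter_upwards [Filter.eventually_ge_atTop 0] with t ht
  have hk := key t ht
  have he : η ^ 2 * Real.exp (-(c / 2) * t) = (η * Real.exp (-(c / 4) * t)) ^ 2 := by
    rw [mul_pow, ← Real.exp_nat_mul]; congr 2; push_cast; ring
  rw [he] at hk
  have b1 : |x t| ≤ η * Real.exp (-(c / 4) * t) :=
    abs_le_of_sq_le_sq (by nlinarith [sq_nonneg (w t), sq_nonneg (x t)]) (by positivity)
  have b2 : |w t| ≤ η * Real.exp (-(c / 4) * t) :=
    abs_le_of_sq_le_sq (by nlinarith [sq_nonneg (w t), sq_nonneg (x t)]) (by positivity)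
  linarith

lemma wc_abstract (X A h : ℝ → ℝ → ℝ → ℝ) (c l η m M : ℝ) (hc : 0 < c) (hl : 0 < l) (hη : 0 < η)
    (hm : 0 < m)
    (hX : ∀ x y s, |x| ≤ η → |y| ≤ η → x * X x y s ≤ -c * x ^ 2)
    (hA : ∀ x y s, |x| ≤ η → |y| ≤ η → |A x y s - A 0 y s| ≤ M * |x|)
    (hh : ∀ x y s, |x| ≤ η → |y| ≤ η → |h x y s - h 0 y s| ≤ M * |x|)
    (hm1 : ∀ y s, |y| ≤ η → m ≤ h 0 y s) (hm2 : ∀ y s, |y| ≤ η → h 0 y s ≤ M)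
    (hAb : ∀ y s, |y| ≤ η → |A 0 y s| ≤ M)
    (hN : ∀ y y' s, |y| ≤ η → |y'| ≤ η →
      |(A 0 y s / h 0 y s + l * y) - (A 0 y' s / h 0 y' s + l * y')| ≤ l / 4 * |y - y'|)
    (hN0 : ∀ s, |A 0 0 s / h 0 0 s| ≤ l * η / 4)
    (hAp : ∀ y s, A 0 y (s + 2 * Real.pi) = A 0 y s)
    (hhp : ∀ y s, h 0 y (s + 2 * Real.pi) = h 0 y s)
    (hAc : Continuous fun p : ℝ × ℝ => A 0 p.1 p.2)
    (hhc : Continuous fun p : ℝ × ℝ => h 0 p.1 p.2) :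
    ∃ (v S : ℝ → ℝ) (T : ℝ), 0 < T ∧ (∀ s, v (s + 2 * Real.pi) = v s) ∧
      (∀ s s', |v s - v s'| ≤ M / m * |s - s'|) ∧ (∀ s, |v s| ≤ η / 2) ∧
      (∀ t, HasDerivAt S (h 0 (v (S t)) (S t)) t) ∧
      (∀ t, HasDerivAt (fun t => v (S t)) (A 0 (v (S t)) (S t)) t) ∧
      (∀ t, S (t + T) = S t + 2 * Real.pi) ∧ Function.Surjective S ∧
      ∃ δ > 0, ∀ x y s : ℝ → ℝ, (∀ t, HasDerivAt x (X (x t) (y t) (s t)) t) →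
        (∀ t, HasDerivAt y (A (x t) (y t) (s t)) t) →
        (∀ t, HasDerivAt s (h (x t) (y t) (s t)) t) →
        |x 0| ≤ δ → |y 0 - v (s 0)| ≤ δ →
        Filter.Tendsto (fun t => |x t| + |y t - v (s t)|) Filter.atTop (nhds 0) := by
  have hM : 0 < M := hm.trans_le ((hm1 0 0 (by simpa using hη.le)).trans (hm2 0 0 (by simpa using hη.le)))
  -- clamp
  set C : ℝ → ℝ := fun y => max (-η) (min η y) with hC
  have hCc : Continuous C := by fun_prop
  have hCb : ∀ y, |C y| ≤ η := fun y => abs_le.2 ⟨le_max_left _ _,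
    max_le (by linarith) (min_le_left _ _)⟩
  have hCid : ∀ y, |y| ≤ η → C y = y := fun y hy => by
    have := abs_le.1 hy
    simp only [hC]
    rw [min_eq_right this.2, max_eq_right this.1]
  have hCl : ∀ y y', |C y - C y'| ≤ |y - y'| := by
    intro y y'
    simp only [hC]
    refine (abs_max_sub_max_le_max _ _ _ _).trans ?_
    refine max_le (by simp) ((abs_min_sub_min_le_max _ _ _ _).trans (max_le (by simp) le_rfl))
  let N : ℝ → ℝ → ℝ := fun s y => A 0 (C y) s / h 0 (C y) s + l * C y
  have hNcont : Continuous (Function.uncurry N) := by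
    have hp : Continuous fun p : ℝ × ℝ => (C p.2, p.1) := by fun_prop
    have h1 := hAc.comp hp
    have h2 := hhc.comp hp
    exact (h1.div h2 fun p => (hm.trans_le (hm1 _ _ (hCb _))).ne').add (by fun_prop)
  obtain ⟨v, hvd, hvp, hvb⟩ := wc_periodic_sol l (l / 4) (l * η / 2) hl (by positivity) (by linarith)
    N hNcont (fun s y => by simp only [N, hAp, hhp])
    (fun s y y' => (hN _ _ s (hCb y) (hCb y')).trans
      (mul_le_mul_of_nonneg_left (hCl y y') (by positivity)))
    (fun s y => by
      have h1 := hN (C y) 0 s (hCb y) (by simpa using hη.le)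
      have h2 := hN0 s
      simp only [mul_zero, add_zero, sub_zero] at h1
      have h3 := abs_sub_abs_le_abs_sub (N s y) (A 0 0 s / h 0 0 s)
      have h4 : l / 4 * |C y| ≤ l / 4 * η := mul_le_mul_of_nonneg_left (hCb y) (by positivity)
      have h5 : |N s y - A 0 0 s / h 0 0 s| ≤ l / 4 * |C y| := h1
      linarith)
  have hvb2 : ∀ s, |v s| ≤ η / 2 := fun s => (hvb s).trans (le_of_eq (by field_simp))
  have hvb1 : ∀ s, |v s| ≤ η := fun s => (hvb2 s).trans (by linarith)
  have hvd' : ∀ s, HasDerivAt v (A 0 (v s) s / h 0 (v s) s) s := fun s => by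
    have := hvd s
    simp only [N, hCid _ (hvb1 s)] at this
    convert this using 1
    ring
  have hFb : ∀ s, |A 0 (v s) s / h 0 (v s) s| ≤ M / m := fun s => by
    have hp := hm1 (v s) s (hvb1 s)
    rw [abs_div, abs_of_pos (hm.trans_le hp)]
    exact div_le_div₀ hM.le (hAb _ _ (hvb1 s)) hm hp
  have hvc : Continuous v := continuous_iff_continuousAt.2 fun s => (hvd' s).continuousAt
  obtain ⟨S, T, hT, hSd, hSp, hSs⟩ := wc_time_param (fun s => h 0 (v s) s) m M hm
    (hhc.comp (hvc.prodMk continuous_id)) (fun s => by simp only [hvp, hhp])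
    (fun s => hm1 _ _ (hvb1 s)) (fun s => hm2 _ _ (hvb1 s))
  obtain ⟨δ, hδ, hst⟩ := wc_stab (min c (m * l / 2)) (M + M / m * M) (η / 2)
    (by positivity) (by positivity)
  refine ⟨v, S, T, hT, hvp, ?_, hvb2, hSd, ?_, hSp, hSs, δ, hδ, ?_⟩
  · intro s s'
    have := Convex.norm_image_sub_le_of_norm_hasDerivWithin_le (f := v)
      (f' := fun s => A 0 (v s) s / h 0 (v s) s) (s := Set.univ) (x := s') (y := s) (C := M / m)
      (fun x _ => (hvd' x).hasDerivWithinAt) (fun x _ => hFb x) convex_univ trivial trivial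
    simpa using this
  · intro t
    have := (hvd' (S t)).comp t (hSd t)
    have hne := (hm.trans_le (hm1 (v (S t)) (S t) (hvb1 _))).ne'
    rw [div_mul_cancel₀ _ hne] at this
    exact this
  · intro x y s hx hy hs hx0 hw0
    refine hst x (fun t => y t - v (s t)) _ _ hx
      (fun t => (hy t).sub ((hvd' (s t)).comp t (hs t))) ?_ hx0 hw0
    intro t bx bw
    have bx1 : |x t| ≤ η := bx.trans (by linarith)
    have by1 : |y t| ≤ η := by
      have h1 := abs_sub_abs_le_abs_sub (y t) (v (s t))
      have h2 := hvb2 (s t)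
      linarith
    constructor
    · refine (hX _ _ _ bx1 by1).trans ?_
      have := min_le_left c (m * l / 2)
      nlinarith [sq_nonneg (x t)]
    · have k1 := hA (x t) (y t) (s t) bx1 by1
      have k2 := hh (x t) (y t) (s t) bx1 by1
      have k3 := hFb (s t)
      have k4 := hN (y t) (v (s t)) (s t) by1 (hvb1 _)
      have k5 := hm1 (y t) (s t) by1
      have k6 := min_le_right c (m * l / 2)
      have k7 : A 0 (y t) (s t) = h 0 (y t) (s t) * (A 0 (y t) (s t) / h 0 (y t) (s t)) := by
        have := (hm.trans_le k5).ne'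
        field_simp
      set F := A 0 (v (s t)) (s t) / h 0 (v (s t)) (s t)
      set F1 := A 0 (y t) (s t) / h 0 (y t) (s t)
      set w := y t - v (s t) with hw
      set h0 := h 0 (y t) (s t)
      have e : A (x t) (y t) (s t) - F * h (x t) (y t) (s t)
          = (A (x t) (y t) (s t) - A 0 (y t) (s t)) - F * (h (x t) (y t) (s t) - h0)
            + h0 * (((F1 + l * y t) - (F + l * v (s t))) - l * w) := by
        rw [k7, hw]; ring
      rw [e]
      set R := (F1 + l * y t) - (F + l * v (s t))
      set a := A (x t) (y t) (s t) - A 0 (y t) (s t)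
      set b := h (x t) (y t) (s t) - h0
      have j1 : w * a ≤ |w| * (M * |x t|) := by
        calc w * a ≤ |w * a| := le_abs_self _
          _ = |w| * |a| := abs_mul _ _
          _ ≤ _ := by gcongr
      have j2 : -(w * (F * b)) ≤ |w| * (M / m * (M * |x t|)) := by
        calc -(w * (F * b)) ≤ |w * (F * b)| := neg_le_abs _
          _ = |w| * (|F| * |b|) := by rw [abs_mul, abs_mul]
          _ ≤ _ := by gcongr
      have j3 : w * R ≤ l / 4 * w ^ 2 := by
        calc w * R ≤ |w * R| := le_abs_self _
          _ = |w| * |R| := abs_mul _ _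
          _ ≤ |w| * (l / 4 * |w|) := by gcongr
          _ = l / 4 * w ^ 2 := by rw [← sq_abs w]; ring
      have j4 : w * R - l * w ^ 2 ≤ -(l / 2) * w ^ 2 := by nlinarith [sq_nonneg w]
      have j5 : h0 * (w * R - l * w ^ 2) ≤ h0 * (-(l / 2) * w ^ 2) :=
        mul_le_mul_of_nonneg_left j4 (hm.le.trans k5)
      have j6 : m * (l / 2 * w ^ 2) ≤ h0 * (l / 2 * w ^ 2) :=
        mul_le_mul_of_nonneg_right k5 (by positivity)
      have j7 : min c (m * l / 2) * w ^ 2 ≤ m * l / 2 * w ^ 2 :=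
        mul_le_mul_of_nonneg_right k6 (sq_nonneg _)
      show w * (a - F * b + h0 * (R - l * w)) ≤ _
      have : w * (a - F * b + h0 * (R - l * w)) = w * a + -(w * (F * b)) + h0 * (w * R - l * w ^ 2) := by
        ring
      rw [this]
      have j8 : |w| * (M * |x t|) + |w| * (M / m * (M * |x t|)) = (M + M / m * M) * (|x t| * |w|) := by
        ring
      linarith

noncomputable def wcX (g q : ℝ → ℝ) (σ ε x y s : ℝ) : ℝ :=
  q x + ε * (g (σ * s) + g (σ * s + (Real.pi + y)) - g (σ * s - x) - g (Real.pi + y + σ * s - x))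

noncomputable def wcA (g q : ℝ → ℝ) (σ ε x y s : ℝ) : ℝ :=
  q (Real.pi + y) + ε * (g (-(σ * s)) + g (x - σ * s) - g (-(Real.pi + y) - σ * s)
    - g (x - (Real.pi + y) - σ * s))

noncomputable def wch (g : ℝ → ℝ) (σ ε x y s : ℝ) : ℝ :=
  σ * (g x - g (Real.pi + y) + ε * (g (σ * s) + g (σ * s + (Real.pi + y)) - g (-(σ * s))
    - g (x - σ * s)))

lemma wc_strict (f : ℝ → ℝ) (a b κ : ℝ) (hκ : 0 < κ) (hf : HasStrictDerivAt f a b) :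
    ∃ η > 0, ∀ x y, |x| ≤ η → |y| ≤ η →
      |f (b + x) - f (b + y) - a * (x - y)| ≤ κ * |x - y| := by
  have h1 := (hasStrictDerivAt_iff_hasStrictFDerivAt.1 hf).isLittleO.bound hκ
  rw [Metric.eventually_nhds_iff] at h1
  obtain ⟨d, hd, hh⟩ := h1
  refine ⟨d / 2, by positivity, fun x y hx hy => ?_⟩
  have := @hh (b + x, b + y) (by
    rw [Prod.dist_eq]
    simp only [Real.dist_eq, add_sub_cancel_left]
    exact max_lt (by linarith) (by linarith))
  simp only [Real.norm_eq_abs, add_sub_add_left_eq_sub] at this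
  convert this using 2
  simp
  ring

lemma wc_quot (n n' h h' ℓ ν m G d : ℝ) (hm : 0 < m) (h1 : m ≤ h) (h2 : m ≤ h') (hd : 0 ≤ d)
    (hn : |n - n'| ≤ ℓ * d) (hn' : |n'| ≤ ν) (hh : |h - h'| ≤ G * d) :
    |n / h - n' / h'| ≤ (ℓ / m + ν * G / m ^ 2) * d := by
  have p1 : 0 < h := hm.trans_le h1
  have p2 : 0 < h' := hm.trans_le h2
  have hν : 0 ≤ ν := (abs_nonneg _).trans hn'
  have e : n / h - n' / h' = (n - n') / h - n' * (h - h') / (h * h') := by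
    field_simp
    ring
  rw [e]
  calc _ ≤ |(n - n') / h| + |n' * (h - h') / (h * h')| := abs_sub _ _
    _ = |n - n'| / h + |n'| * |h - h'| / (h * h') := by
      rw [abs_div, abs_div, abs_mul, abs_of_pos p1, abs_of_pos (mul_pos p1 p2)]
    _ ≤ (ℓ * d) / m + ν * (G * d) / (m * m) := by
      have : 0 ≤ ℓ * d := (abs_nonneg _).trans hn
      have : 0 ≤ G * d := (abs_nonneg _).trans hh
      gcongr
    _ = _ := by field_simp

lemma wc_small (a b : ℝ) (hb : 0 < b) : ∀ᶠ κ in nhdsWithin (0:ℝ) (Set.Ioi 0), a * κ ≤ b := by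
  have : Filter.Tendsto (fun κ : ℝ => a * κ) (nhds 0) (nhds 0) := by
    have : Continuous fun κ : ℝ => a * κ := by fun_prop
    simpa using this.tendsto 0
  exact ((this.eventually_lt_const hb).filter_mono nhdsWithin_le_nhds).mono fun _ h => h.le

lemma wc_est (g q : ℝ → ℝ) (G Ω c0 μ σ : ℝ) (hG : 1 ≤ G) (hΩ : 0 < Ω) (hc0 : 0 < c0) (hμ : 0 < μ)
    (hσ : σ = 1 ∨ σ = -1) (glip : ∀ a b, |g a - g b| ≤ G * |a - b|) (gb : ∀ a, |g a| ≤ G)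
    (gper : ∀ (a b : ℝ) (k : ℤ), a = b + 2 * Real.pi * k → g a = g b)
    (gc : Continuous g) (hq : ∀ x, q x = g x - g (-x)) (hΩe : σ * (g 0 - g Real.pi) = Ω)
    (hq0 : HasStrictDerivAt q (-c0) 0) (hqp : HasStrictDerivAt q (-μ) Real.pi) :
    ∃ ε₀ > 0, ∀ ε : ℝ, |ε| < ε₀ → ∃ c l η m M : ℝ, 0 < c ∧ 0 < l ∧ 0 < η ∧ 0 < m ∧ 0 < M ∧
    (∀ x y s, |x| ≤ η → |y| ≤ η → x * wcX g q σ ε x y s ≤ -c * x ^ 2) ∧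
    (∀ x y s, |x| ≤ η → |y| ≤ η → |wcA g q σ ε x y s - wcA g q σ ε 0 y s| ≤ M * |x|) ∧
    (∀ x y s, |x| ≤ η → |y| ≤ η → |wch g σ ε x y s - wch g σ ε 0 y s| ≤ M * |x|) ∧
    (∀ y s, |y| ≤ η → m ≤ wch g σ ε 0 y s) ∧ (∀ y s, |y| ≤ η → wch g σ ε 0 y s ≤ M) ∧
    (∀ y s, |y| ≤ η → |wcA g q σ ε 0 y s| ≤ M) ∧
    (∀ y y' s, |y| ≤ η → |y'| ≤ η →
      |(wcA g q σ ε 0 y s / wch g σ ε 0 y s + l * y) -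
        (wcA g q σ ε 0 y' s / wch g σ ε 0 y' s + l * y')| ≤ l / 4 * |y - y'|) ∧
    (∀ s, |wcA g q σ ε 0 0 s / wch g σ ε 0 0 s| ≤ l * η / 4) ∧
    (∀ y s, wcA g q σ ε 0 y (s + 2 * Real.pi) = wcA g q σ ε 0 y s) ∧
    (∀ y s, wch g σ ε 0 y (s + 2 * Real.pi) = wch g σ ε 0 y s) ∧
    (Continuous fun p : ℝ × ℝ => wcA g q σ ε 0 p.1 p.2) ∧
    (Continuous fun p : ℝ × ℝ => wch g σ ε 0 p.1 p.2) := by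
  have qc : Continuous q := by
    have : q = fun x => g x - g (-x) := funext hq
    rw [this]; fun_prop
  have q00 : q 0 = 0 := by rw [hq]; simp
  have qpi0 : q Real.pi = 0 := by
    rw [hq, gper Real.pi (-Real.pi) 1 (by push_cast; ring)]; simp
  have hσa : |σ| = 1 := by rcases hσ with h | h <;> simp [h]
  obtain ⟨l, hl, hlΩ⟩ : ∃ l, 0 < l ∧ l * Ω = μ := ⟨μ / Ω, by positivity, by field_simp⟩
  set m := Ω / 2 with hmdef
  have hm : 0 < m := by positivity
  set c1 := 1 + 7 * l * G + 2 * G with hc1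
  have hc1p : 0 < c1 := by positivity
  obtain ⟨κ, hκ, κ1, κ2, κ3, κ4, κ5⟩ : ∃ κ : ℝ, 0 < κ ∧ 1 * κ ≤ 1 ∧ (5 * G) * κ ≤ Ω / 2 ∧
      (2 * G) * κ ≤ c0 / 4 ∧ (c1 / m + (4 * G + c1) * (2 * G) / m ^ 2) * κ ≤ l / 4 ∧
      (4 * G / m) * κ ≤ l / 4 := by
    have h := (eventually_mem_nhdsWithin (a := (0:ℝ)) (s := Set.Ioi 0)).and
      ((wc_small 1 1 one_pos).and ((wc_small (5 * G) (Ω / 2) (by positivity)).and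
      ((wc_small (2 * G) (c0 / 4) (by positivity)).and
      ((wc_small (c1 / m + (4 * G + c1) * (2 * G) / m ^ 2) (l / 4) (by positivity)).and
      (wc_small (4 * G / m) (l / 4) (by positivity))))))
    obtain ⟨κ, h1, h2⟩ := h.exists
    exact ⟨κ, h1, h2⟩
  rw [one_mul] at κ1
  obtain ⟨η1, hη1, s1⟩ := wc_strict q (-c0) 0 (c0 / 4) (by positivity) hq0
  obtain ⟨η2, hη2, s2⟩ := wc_strict q (-μ) Real.pi κ hκ hqp
  obtain ⟨η, hη, ηκ, ηη1, ηη2⟩ : ∃ η : ℝ, 0 < η ∧ η ≤ κ ∧ η ≤ η1 ∧ η ≤ η2 :=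
    ⟨min κ (min η1 η2), by positivity, min_le_left _ _, (min_le_right _ _).trans (min_le_left _ _),
      (min_le_right _ _).trans (min_le_right _ _)⟩
  refine ⟨κ * η, by positivity, fun ε hε => ?_⟩
  have hη1' : η ≤ 1 := ηκ.trans κ1
  have εκη : |ε| ≤ κ * η := hε.le
  have εκ : |ε| ≤ κ := εκη.trans (mul_le_of_le_one_right hκ.le hη1')
  have ε1 : |ε| ≤ 1 := εκ.trans κ1
  have hε0 := abs_nonneg ε
  -- generic bounds
  have abs4 : ∀ a b c d : ℝ, |a| ≤ G → |b| ≤ G → |c| ≤ G → |d| ≤ G → |a + b - c - d| ≤ 4 * G := by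
    intro a b c d h1 h2 h3 h4
    rw [abs_le] at *
    constructor <;> linarith
  have εmul : ∀ a D : ℝ, |a| ≤ D → |ε * a| ≤ |ε| * D := fun a D h => by
    rw [abs_mul]; gcongr
  -- h
  have hdiff : ∀ y s, |wch g σ ε 0 y s - Ω| ≤ G * |y| + |ε| * (4 * G) := by
    intro y s
    have e : wch g σ ε 0 y s - Ω = σ * ((g Real.pi - g (Real.pi + y)) +
        ε * (g (σ * s) + g (σ * s + (Real.pi + y)) - g (-(σ * s)) - g (0 - σ * s))) := by
      rw [← hΩe, wch]; ring
    rw [e, abs_mul, hσa, one_mul]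
    refine (abs_add_le _ _).trans (add_le_add ?_ (εmul _ _ (abs4 _ _ _ _ (gb _) (gb _) (gb _) (gb _))))
    have := glip Real.pi (Real.pi + y)
    simpa using this
  have hdiff2 : ∀ y s, |y| ≤ η → |wch g σ ε 0 y s - Ω| ≤ G * η + |ε| * (4 * G) := fun y s hy =>
    (hdiff y s).trans (by gcongr)
  have hhm : ∀ y s, |y| ≤ η → m ≤ wch g σ ε 0 y s := by
    intro y s hy
    have h1 := (abs_le.1 (hdiff2 y s hy)).1
    have h2 : G * η ≤ G * κ := by gcongr
    have h3 : |ε| * (4 * G) ≤ κ * (4 * G) := by gcongr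
    rw [hmdef]
    linarith
  have hhl : ∀ y y' s, |wch g σ ε 0 y s - wch g σ ε 0 y' s| ≤ 2 * G * |y - y'| := by
    intro y y' s
    have e : wch g σ ε 0 y s - wch g σ ε 0 y' s = σ * ((g (Real.pi + y') - g (Real.pi + y)) +
        ε * (g (σ * s + (Real.pi + y)) - g (σ * s + (Real.pi + y')))) := by
      rw [wch, wch]; ring
    rw [e, abs_mul, hσa, one_mul]
    have h1 := glip (Real.pi + y') (Real.pi + y)
    have h2 := glip (σ * s + (Real.pi + y)) (σ * s + (Real.pi + y'))
    simp only [add_sub_add_left_eq_sub] at h1 h2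
    rw [abs_sub_comm y' y] at h1
    refine (abs_add_le _ _).trans ((add_le_add h1 (εmul _ _ h2)).trans ?_)
    have : |ε| * (G * |y - y'|) ≤ 1 * (G * |y - y'|) := by gcongr
    linarith
  -- the numerator
  let Nn : ℝ → ℝ → ℝ := fun y s => wcA g q σ ε 0 y s + l * y * wch g σ ε 0 y s
  have hNl : ∀ y y' s, |y| ≤ η → |y'| ≤ η → |Nn y s - Nn y' s| ≤ (κ * c1) * |y - y'| := by
    intro y y' s hy hy'
    have e : Nn y s - Nn y' s = (q (Real.pi + y) - q (Real.pi + y') - (-μ) * (y - y'))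
        + l * ((y - y') * (wch g σ ε 0 y s - Ω) + y' * (wch g σ ε 0 y s - wch g σ ε 0 y' s))
        + ε * ((g (-(Real.pi + y') - σ * s) - g (-(Real.pi + y) - σ * s))
          + (g (0 - (Real.pi + y') - σ * s) - g (0 - (Real.pi + y) - σ * s))) := by
      simp only [Nn, wcA]
      linear_combination (y - y') * hlΩ
    rw [e]
    have t1 := s2 y y' (hy.trans ηη2) (hy'.trans ηη2)
    have t2 : |l * ((y - y') * (wch g σ ε 0 y s - Ω) + y' * (wch g σ ε 0 y s - wch g σ ε 0 y' s))|
        ≤ l * (|y - y'| * (G * η + |ε| * (4 * G)) + η * (2 * G * |y - y'|)) := by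
      rw [abs_mul, abs_of_pos hl]
      refine mul_le_mul_of_nonneg_left ((abs_add_le _ _).trans ?_) hl.le
      rw [abs_mul, abs_mul]
      have := hdiff2 y s hy
      have := hhl y y' s
      gcongr
    have t3 := εmul _ (2 * G * |y - y'|) (by
      have h1 := glip (-(Real.pi + y') - σ * s) (-(Real.pi + y) - σ * s)
      have h2 := glip (0 - (Real.pi + y') - σ * s) (0 - (Real.pi + y) - σ * s)
      rw [show -(Real.pi + y') - σ * s - (-(Real.pi + y) - σ * s) = y - y' by ring] at h1
      rw [show 0 - (Real.pi + y') - σ * s - (0 - (Real.pi + y) - σ * s) = y - y' by ring] at h2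
      exact (abs_add_le _ _).trans ((add_le_add h1 h2).trans (by linarith)))
    refine (abs_add_three _ _ _).trans ((add_le_add (add_le_add t1 t2) t3).trans ?_)
    have hd := abs_nonneg (y - y')
    have u : κ + l * (G * η + |ε| * (4 * G) + η * (2 * G)) + |ε| * (2 * G) ≤ κ * c1 := by
      have : κ + l * (G * η + |ε| * (4 * G) + η * (2 * G)) + |ε| * (2 * G) ≤
        κ + l * (G * κ + κ * (4 * G) + κ * (2 * G)) + κ * (2 * G) := by gcongr
      rw [hc1]
      linarith
    have := mul_le_mul_of_nonneg_right u hd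
    linarith
  have hA0 : ∀ s, |wcA g q σ ε 0 0 s| ≤ |ε| * (4 * G) := by
    intro s
    rw [wcA, add_zero, qpi0, zero_add]
    exact εmul _ _ (abs4 _ _ _ _ (gb _) (gb _) (gb _) (gb _))
  have hNb : ∀ y s, |y| ≤ η → |Nn y s| ≤ κ * (4 * G + c1) := by
    intro y s hy
    have h1 := hNl y 0 s hy (by simpa using hη.le)
    have h2 : Nn 0 s = wcA g q σ ε 0 0 s := by simp [Nn]
    have h3 := hA0 s
    rw [← h2] at h3
    rw [sub_zero] at h1
    have h4 := abs_sub_abs_le_abs_sub (Nn y s) (Nn 0 s)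
    have h5 : κ * c1 * |y| ≤ κ * c1 * 1 := by gcongr; exact hy.trans hη1'
    have h6 : |ε| * (4 * G) ≤ κ * (4 * G) := by gcongr
    linarith
  refine ⟨c0 / 2, l, η, m, 6 * G, by positivity, hl, hη, hm, by positivity, ?_, ?_, ?_, hhm, ?_, ?_, ?_,
    ?_, ?_, ?_, ?_, ?_⟩
  · intro x y s hx hy
    have t1 := s1 x 0 (hx.trans ηη1) (by simpa using hη1.le)
    simp only [zero_add, q00, sub_zero, add_zero] at t1
    have t2 := εmul (g (σ * s) + g (σ * s + (Real.pi + y)) - g (σ * s - x) - g (Real.pi + y + σ * s - x))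
      (2 * G * |x|) (by
        have h1 := glip (σ * s) (σ * s - x)
        have h2 := glip (σ * s + (Real.pi + y)) (Real.pi + y + σ * s - x)
        rw [show σ * s - (σ * s - x) = x by ring] at h1
        rw [show σ * s + (Real.pi + y) - (Real.pi + y + σ * s - x) = x by ring] at h2
        have e : g (σ * s) + g (σ * s + (Real.pi + y)) - g (σ * s - x) - g (Real.pi + y + σ * s - x)
          = (g (σ * s) - g (σ * s - x)) + (g (σ * s + (Real.pi + y)) - g (Real.pi + y + σ * s - x)) := by
          ring
        rw [e]
        exact (abs_add_le _ _).trans ((add_le_add h1 h2).trans (by linarith)))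
    rw [wcX]
    set P := ε * (g (σ * s) + g (σ * s + (Real.pi + y)) - g (σ * s - x) - g (Real.pi + y + σ * s - x))
    have t3 : |P| ≤ c0 / 4 * |x| := t2.trans (by
      have : |ε| * (2 * G * |x|) ≤ κ * (2 * G * |x|) := by gcongr
      have := mul_le_mul_of_nonneg_right κ3 (abs_nonneg x)
      linarith)
    have t4 : x * (q x - -c0 * x) ≤ |x| * (c0 / 4 * |x|) := by
      calc _ ≤ |x * (q x - -c0 * x)| := le_abs_self _
        _ = |x| * |q x - -c0 * x| := abs_mul _ _
        _ ≤ _ := by gcongr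
    have t5 : x * P ≤ |x| * (c0 / 4 * |x|) := by
      calc _ ≤ |x * P| := le_abs_self _
        _ = |x| * |P| := abs_mul _ _
        _ ≤ _ := by gcongr
    have t6 : |x| * (c0 / 4 * |x|) = c0 / 4 * x ^ 2 := by rw [← sq_abs x]; ring
    rw [t6] at t4 t5
    linarith
  · intro x y s hx hy
    have e : wcA g q σ ε x y s - wcA g q σ ε 0 y s = ε * ((g (x - σ * s) - g (0 - σ * s)) -
        (g (x - (Real.pi + y) - σ * s) - g (0 - (Real.pi + y) - σ * s))) := by
      rw [wcA, wcA]; ring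
    rw [e]
    have h1 := glip (x - σ * s) (0 - σ * s)
    have h2 := glip (x - (Real.pi + y) - σ * s) (0 - (Real.pi + y) - σ * s)
    simp only [sub_sub_sub_cancel_right, sub_zero] at h1 h2
    refine (εmul _ (2 * G * |x|) ((abs_sub _ _).trans ((add_le_add h1 h2).trans (by linarith)))).trans ?_
    have : |ε| * (2 * G * |x|) ≤ 1 * (2 * G * |x|) := by gcongr
    have : 0 ≤ G * |x| := by positivity
    linarith
  · intro x y s hx hy
    have e : wch g σ ε x y s - wch g σ ε 0 y s = σ * ((g x - g 0) +
        ε * (g (0 - σ * s) - g (x - σ * s))) := by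
      rw [wch, wch]; ring
    rw [e, abs_mul, hσa, one_mul]
    have h1 := glip x 0
    have h2 := glip (0 - σ * s) (x - σ * s)
    rw [sub_zero] at h1
    rw [sub_sub_sub_cancel_right, zero_sub x, abs_neg] at h2
    refine (abs_add_le _ _).trans ((add_le_add h1 (εmul _ _ h2)).trans ?_)
    have : |ε| * (G * |x|) ≤ 1 * (G * |x|) := by gcongr
    have : 0 ≤ G * |x| := by positivity
    linarith
  · intro y s hy
    have h1 := (abs_le.1 (hdiff2 y s hy)).2
    have h2 : Ω ≤ 2 * G := by
      rw [← hΩe]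
      refine (le_abs_self _).trans ?_
      rw [abs_mul, hσa, one_mul]
      exact (abs_sub _ _).trans (by linarith [gb 0, gb Real.pi])
    have h3 : G * η ≤ G * κ := by gcongr
    have h4 : |ε| * (4 * G) ≤ κ * (4 * G) := by gcongr
    linarith
  · intro y s hy
    rw [wcA]
    refine (abs_add_le _ _).trans ((add_le_add ?_ (εmul _ _ (abs4 _ _ _ _ (gb _) (gb _) (gb _) (gb _)))).trans
      (?_ : 2 * G + |ε| * (4 * G) ≤ 6 * G))
    · rw [hq]
      exact (abs_sub _ _).trans (by linarith [gb (Real.pi + y), gb (-(Real.pi + y))])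
    · have : |ε| * (4 * G) ≤ 1 * (4 * G) := by gcongr
      linarith
  · intro y y' s hy hy'
    have e : ∀ y, |y| ≤ η → wcA g q σ ε 0 y s / wch g σ ε 0 y s + l * y = Nn y s / wch g σ ε 0 y s := by
      intro y hy
      have := (hm.trans_le (hhm y s hy)).ne'
      simp only [Nn]
      field_simp
    rw [e y hy, e y' hy']
    refine (wc_quot _ _ _ _ _ _ m (2 * G) _ hm (hhm y s hy) (hhm y' s hy') (abs_nonneg (y - y'))
      (hNl y y' s hy hy') (hNb y' s hy') (hhl y y' s)).trans ?_
    refine mul_le_mul_of_nonneg_right (le_trans (le_of_eq ?_) κ4) (abs_nonneg _)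
    field_simp
  · intro s
    have h0 : |(0:ℝ)| ≤ η := by simpa using hη.le
    have hp := hhm 0 s h0
    rw [abs_div, abs_of_pos (hm.trans_le hp)]
    calc _ ≤ (κ * η * (4 * G)) / m := by
          refine div_le_div₀ (by positivity) ((hA0 s).trans (by gcongr)) hm hp
      _ = (4 * G / m) * κ * η := by field_simp
      _ ≤ l / 4 * η := by gcongr
      _ = _ := by ring
  · intro y s
    obtain ⟨k, hk⟩ : ∃ k : ℤ, σ = k := by
      rcases hσ with h | h
      · exact ⟨1, by simp [h]⟩
      · exact ⟨-1, by simp [h]⟩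
    simp only [wcA]
    rw [gper (-(σ * (s + 2 * Real.pi))) (-(σ * s)) (-k) (by push_cast; rw [← hk]; ring),
      gper (0 - σ * (s + 2 * Real.pi)) (0 - σ * s) (-k) (by push_cast; rw [← hk]; ring),
      gper (-(Real.pi + y) - σ * (s + 2 * Real.pi)) (-(Real.pi + y) - σ * s) (-k)
        (by push_cast; rw [← hk]; ring),
      gper (0 - (Real.pi + y) - σ * (s + 2 * Real.pi)) (0 - (Real.pi + y) - σ * s) (-k)
        (by push_cast; rw [← hk]; ring)]
  · intro y s
    obtain ⟨k, hk⟩ : ∃ k : ℤ, σ = k := by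
      rcases hσ with h | h
      · exact ⟨1, by simp [h]⟩
      · exact ⟨-1, by simp [h]⟩
    simp only [wch]
    rw [gper (-(σ * (s + 2 * Real.pi))) (-(σ * s)) (-k) (by push_cast; rw [← hk]; ring),
      gper (0 - σ * (s + 2 * Real.pi)) (0 - σ * s) (-k) (by push_cast; rw [← hk]; ring),
      gper (σ * (s + 2 * Real.pi)) (σ * s) k (by rw [← hk]; ring),
      gper (σ * (s + 2 * Real.pi) + (Real.pi + y)) (σ * s + (Real.pi + y)) k
        (by rw [← hk]; ring)]
  · simp only [wcA]; fun_prop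
  · simp only [wch]; fun_prop

/-- Existence of attracting weak chimeras in the four-oscillator network: for the
Hansel–Mato–Meunier coupling `g φ = -sin (φ - α) + r sin (2φ)` with `r < -|cos α|/2`
and `sin α ≠ 0`, there is `ε₀ > 0` such that for all `|ε| < ε₀` the reduced system has
a periodic solution (of period `T` with winding `2πσ`, `σ = ±1`, in the `φ₃` direction)
which is asymptotically stable (nearby solutions converge to the lifted orbit `Γ`), with
`φ₁, φ₂` bounded and `φ₃(t)/t → 2πσ/T ≠ 0`: a weak chimera with
`Ω₁₃ = Ω₂₄ = 0` and `Ω₁₂ ≠ 0`. -/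
theorem four_oscillator_attracting_weak_chimera
    (α r : ℝ) (g q : ℝ → ℝ)
    (hg : ∀ φ, g φ = -Real.sin (φ - α) + r * Real.sin (2 * φ))
    (hq : ∀ φ, q φ = g φ - g (-φ))
    (hr : r < -|Real.cos α| / 2) (hα : Real.sin α ≠ 0) :
    ∃ ε₀ > 0, ∀ ε : ℝ, |ε| < ε₀ →
      ∃ (φ₁ φ₂ φ₃ : ℝ → ℝ) (T σ : ℝ),
        (σ = 1 ∨ σ = -1) ∧ 0 < T ∧
        (∀ t, HasDerivAt φ₁
          (q (φ₁ t) + ε * (g (φ₃ t) + g (φ₃ t + φ₂ t) - g (φ₃ t - φ₁ t)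
            - g (φ₂ t + φ₃ t - φ₁ t))) t) ∧
        (∀ t, HasDerivAt φ₂
          (q (φ₂ t) + ε * (g (-φ₃ t) + g (φ₁ t - φ₃ t) - g (-φ₂ t - φ₃ t)
            - g (φ₁ t - φ₂ t - φ₃ t))) t) ∧
        (∀ t, HasDerivAt φ₃
          (g (φ₁ t) - g (φ₂ t) + ε * (g (φ₃ t) + g (φ₃ t + φ₂ t) - g (-φ₃ t)
            - g (φ₁ t - φ₃ t))) t) ∧
        (∀ t, φ₁ (t + T) = φ₁ t) ∧
        (∀ t, φ₂ (t + T) = φ₂ t) ∧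
        (∀ t, φ₃ (t + T) = φ₃ t + 2 * Real.pi * σ) ∧
        (∃ δ > 0, ∀ ψ₁ ψ₂ ψ₃ : ℝ → ℝ,
          (∀ t, HasDerivAt ψ₁
            (q (ψ₁ t) + ε * (g (ψ₃ t) + g (ψ₃ t + ψ₂ t) - g (ψ₃ t - ψ₁ t)
              - g (ψ₂ t + ψ₃ t - ψ₁ t))) t) →
          (∀ t, HasDerivAt ψ₂
            (q (ψ₂ t) + ε * (g (-ψ₃ t) + g (ψ₁ t - ψ₃ t) - g (-ψ₂ t - ψ₃ t)
              - g (ψ₁ t - ψ₂ t - ψ₃ t))) t) →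
          (∀ t, HasDerivAt ψ₃
            (g (ψ₁ t) - g (ψ₂ t) + ε * (g (ψ₃ t) + g (ψ₃ t + ψ₂ t) - g (-ψ₃ t)
              - g (ψ₁ t - ψ₃ t))) t) →
          Metric.infDist (ψ₁ 0, ψ₂ 0, ψ₃ 0)
            {p : ℝ × ℝ × ℝ | ∃ (s : ℝ) (k₁ k₂ k₃ : ℤ),
              p = (φ₁ s + 2 * Real.pi * k₁, φ₂ s + 2 * Real.pi * k₂,
                    φ₃ s + 2 * Real.pi * k₃)} < δ →
          Filter.Tendsto (fun t => Metric.infDist (ψ₁ t, ψ₂ t, ψ₃ t)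
            {p : ℝ × ℝ × ℝ | ∃ (s : ℝ) (k₁ k₂ k₃ : ℤ),
              p = (φ₁ s + 2 * Real.pi * k₁, φ₂ s + 2 * Real.pi * k₂,
                    φ₃ s + 2 * Real.pi * k₃)}) Filter.atTop (nhds 0)) ∧
        (∃ C : ℝ, ∀ t, |φ₁ t| ≤ C ∧ |φ₂ t| ≤ C) ∧
        Filter.Tendsto (fun t : ℝ => φ₃ t / t) Filter.atTop
          (nhds (2 * Real.pi * σ / T)) ∧
        2 * Real.pi * σ / T ≠ 0 := by
  obtain ⟨σ, hσ, hσs⟩ : ∃ σ : ℝ, (σ = 1 ∨ σ = -1) ∧ σ * Real.sin α = |Real.sin α| := by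
    rcases le_total 0 (Real.sin α) with h | h
    · exact ⟨1, Or.inl rfl, by rw [abs_of_nonneg h, one_mul]⟩
    · exact ⟨-1, Or.inr rfl, by rw [abs_of_nonpos h]; ring⟩
  have hσσ : σ * σ = 1 := by rcases hσ with h | h <;> simp [h]
  have hσa : |σ| = 1 := by rcases hσ with h | h <;> simp [h]
  have gfun : g = fun φ => -Real.sin (φ - α) + r * Real.sin (2 * φ) := funext hg
  have gc : Continuous g := by rw [gfun]; fun_prop
  have gb : ∀ a, |g a| ≤ 1 + 2 * |r| := by
    intro a
    rw [hg]
    refine (abs_add_le _ _).trans ?_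
    rw [abs_neg, abs_mul]
    have h1 := Real.abs_sin_le_one (a - α)
    have h2 := mul_le_mul_of_nonneg_left (Real.abs_sin_le_one (2 * a)) (abs_nonneg r)
    linarith [abs_nonneg r]
  have sinl : ∀ a b : ℝ, |Real.sin a - Real.sin b| ≤ |a - b| := by
    intro a b
    have := Convex.norm_image_sub_le_of_norm_hasDerivWithin_le (f := Real.sin)
      (f' := Real.cos) (s := Set.univ) (x := b) (y := a) (C := 1)
      (fun x _ => (Real.hasDerivAt_sin x).hasDerivWithinAt) (fun x _ => Real.abs_cos_le_one x)
      convex_univ trivial trivial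
    simpa using this
  have glip : ∀ a b, |g a - g b| ≤ (1 + 2 * |r|) * |a - b| := by
    intro a b
    rw [hg, hg]
    have h1 := sinl (b - α) (a - α)
    have h2 := sinl (2 * a) (2 * b)
    rw [sub_sub_sub_cancel_right, abs_sub_comm b a] at h1
    rw [← mul_sub, abs_mul, abs_two] at h2
    have e : -Real.sin (a - α) + r * Real.sin (2 * a) - (-Real.sin (b - α) + r * Real.sin (2 * b))
      = (Real.sin (b - α) - Real.sin (a - α)) + r * (Real.sin (2 * a) - Real.sin (2 * b)) := by ring
    rw [e]
    refine (abs_add_le _ _).trans ?_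
    rw [abs_mul]
    have h3 := mul_le_mul_of_nonneg_left h2 (abs_nonneg r)
    linarith
  have gper : ∀ (a b : ℝ) (k : ℤ), a = b + 2 * Real.pi * k → g a = g b := by
    intro a b k h
    rw [hg, hg, h]
    rw [show b + 2 * Real.pi * k - α = (b - α) + k * (2 * Real.pi) by ring,
      show 2 * (b + 2 * Real.pi * k) = 2 * b + ((2 * k : ℤ) : ℝ) * (2 * Real.pi) by push_cast; ring,
      Real.sin_add_int_mul_two_pi, Real.sin_add_int_mul_two_pi]
  have qform : ∀ φ, q φ = 2 * Real.sin φ * (-Real.cos α + 2 * r * Real.cos φ) := by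
    intro φ
    rw [hq, hg, hg, Real.sin_sub, Real.sin_sub, Real.sin_neg, Real.cos_neg,
      show 2 * -φ = -(2 * φ) by ring, Real.sin_neg, Real.sin_two_mul]
    ring
  have qper : ∀ (a b : ℝ) (k : ℤ), a = b + 2 * Real.pi * k → q a = q b := by
    intro a b k h
    rw [hq, hq, gper a b k h, gper (-a) (-b) (-k) (by rw [h]; push_cast; ring)]
  have qd : ∀ b, HasStrictDerivAt q (2 * Real.cos b * (-Real.cos α + 2 * r * Real.cos b) +
      2 * Real.sin b * (2 * r * -Real.sin b)) b := by
    intro b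
    rw [show q = fun φ => 2 * Real.sin φ * (-Real.cos α + 2 * r * Real.cos φ) from funext qform]
    exact ((Real.hasStrictDerivAt_sin b).const_mul 2).mul
      (((Real.hasStrictDerivAt_cos b).const_mul (2 * r)).const_add _)
  have hq0 : HasStrictDerivAt q (-(2 * Real.cos α - 4 * r)) 0 := by
    convert qd 0 using 1
    simp; ring
  have hqp : HasStrictDerivAt q (-(-2 * Real.cos α - 4 * r)) Real.pi := by
    convert qd Real.pi using 1
    simp; ring
  have hc1 := le_abs_self (Real.cos α)
  have hc2 := neg_le_abs (Real.cos α)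
  have hsp : 0 < |Real.sin α| := abs_pos.2 hα
  obtain ⟨ε₀, hε₀, hest⟩ := wc_est g q (1 + 2 * |r|) (2 * |Real.sin α|) (2 * Real.cos α - 4 * r)
    (-2 * Real.cos α - 4 * r) σ (by linarith [abs_nonneg r]) (by linarith) (by linarith) (by linarith)
    hσ glip gb gper gc hq (by
      rw [hg, hg, ← hσs, Real.sin_pi_sub, mul_zero, Real.sin_zero, Real.sin_two_pi, zero_sub,
        Real.sin_neg]
      ring) hq0 hqp
  refine ⟨ε₀, hε₀, fun ε hε => ?_⟩
  obtain ⟨c, l, η, m, M, hc, hl, hη, hm, hM, hX, hA, hh, hm1, hm2, hAb, hN, hN0, hAp, hhp, hAc, hhc⟩ :=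
    hest ε hε
  obtain ⟨v, S, T, hT, hvp, hvl, hvb, hSd, hvSd, hSp, hSs, δ, hδ, hst⟩ :=
    wc_abstract (wcX g q σ ε) (wcA g q σ ε) (wch g σ ε) c l η m M hc hl hη hm hX hA hh hm1 hm2 hAb
      hN hN0 hAp hhp hAc hhc
  have hvpk : ∀ (s : ℝ) (k : ℤ), v (s + 2 * Real.pi * k) = v s := by
    intro s k
    have hp : Function.Periodic v (2 * Real.pi) := hvp
    have := (hp.int_mul k) s
    rw [← this]; congr 1; ring
  have hSc : Continuous S := continuous_iff_continuousAt.2 fun s => (hSd s).continuousAt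
  refine ⟨fun _ => 0, fun t => Real.pi + v (S t), fun t => σ * S t, T, σ, hσ, hT, ?_, ?_, ?_,
    fun _ => rfl, ?_, ?_, ?_, ?_, ?_, ?_⟩
  · intro t
    have e : q 0 + ε * (g (σ * S t) + g (σ * S t + (Real.pi + v (S t))) - g (σ * S t - 0)
        - g (Real.pi + v (S t) + σ * S t - 0)) = 0 := by
      rw [sub_zero, sub_zero, add_comm (σ * S t), qform]
      simp
    simp only [e]
    exact hasDerivAt_const t 0
  · intro t
    exact (hvSd t).const_add Real.pi
  · intro t
    have := (hSd t).const_mul σ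
    rw [wch, ← mul_assoc, hσσ, one_mul] at this
    exact this
  · intro t
    simp only [hSp, hvp]
  · intro t
    simp only [hSp]; ring
  · set Γ := {p : ℝ × ℝ × ℝ | ∃ (s : ℝ) (k₁ k₂ k₃ : ℤ),
              p = (0 + 2 * Real.pi * k₁, Real.pi + v (S s) + 2 * Real.pi * k₂,
                    σ * S s + 2 * Real.pi * k₃)} with hΓ
    have hΓne : Γ.Nonempty := ⟨_, 0, 0, 0, 0, rfl⟩
    refine ⟨δ / (1 + M / m), by positivity, ?_⟩
    intro ψ₁ ψ₂ ψ₃ h1 h2 h3 hd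
    obtain ⟨p, ⟨s0, k₁, k₂, k₃, rfl⟩, hp⟩ := (Metric.infDist_lt_iff hΓne).1 hd
    rw [Prod.dist_eq, Prod.dist_eq, max_lt_iff, max_lt_iff] at hp
    simp only [Real.dist_eq] at hp
    obtain ⟨p1, p2, p3⟩ := hp
    have hδ' : δ / (1 + M / m) ≤ δ := div_le_self hδ.le (by
      have : 0 < M / m := by positivity
      linarith)
    have hconv := hst (fun t => ψ₁ t - 2 * Real.pi * k₁) (fun t => ψ₂ t - 2 * Real.pi * k₂ - Real.pi)
      (fun t => σ * ψ₃ t) ?_ ?_ ?_ ?_ ?_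
    · refine squeeze_zero (fun t => Metric.infDist_nonneg) (fun t => ?_) hconv
      obtain ⟨s', hs'⟩ := hSs (σ * ψ₃ t)
      have hmem : (0 + 2 * Real.pi * (k₁ : ℝ), Real.pi + v (S s') + 2 * Real.pi * (k₂ : ℝ),
          σ * S s' + 2 * Real.pi * ((0 : ℤ) : ℝ)) ∈ Γ := ⟨s', k₁, k₂, 0, rfl⟩
      refine (Metric.infDist_le_dist_of_mem hmem).trans ?_
      rw [Prod.dist_eq, Prod.dist_eq, hs', ← mul_assoc, hσσ]
      simp only [Real.dist_eq]
      rw [show ψ₁ t - (0 + 2 * Real.pi * (k₁ : ℝ)) = ψ₁ t - 2 * Real.pi * k₁ by ring,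
        show ψ₂ t - (Real.pi + v (σ * ψ₃ t) + 2 * Real.pi * (k₂ : ℝ))
          = ψ₂ t - 2 * Real.pi * k₂ - Real.pi - v (σ * ψ₃ t) by ring]
      have a1 := abs_nonneg (ψ₁ t - 2 * Real.pi * k₁)
      have a2 := abs_nonneg (ψ₂ t - 2 * Real.pi * k₂ - Real.pi - v (σ * ψ₃ t))
      refine max_le (by linarith) (max_le (by linarith) ?_)
      simp
      linarith
    · intro t
      have e := (h1 t).sub_const (2 * Real.pi * k₁)
      refine e.congr_deriv ?_
      simp only [wcX]
      rw [← mul_assoc, hσσ, one_mul]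
      rw [qper (ψ₁ t) (ψ₁ t - 2 * Real.pi * k₁) k₁ (by ring),
        gper (ψ₃ t + ψ₂ t) (ψ₃ t + (Real.pi + (ψ₂ t - 2 * Real.pi * k₂ - Real.pi))) k₂ (by ring),
        gper (ψ₃ t - ψ₁ t) (ψ₃ t - (ψ₁ t - 2 * Real.pi * k₁)) (-k₁) (by push_cast; ring),
        gper (ψ₂ t + ψ₃ t - ψ₁ t) (Real.pi + (ψ₂ t - 2 * Real.pi * k₂ - Real.pi) + ψ₃ t -
          (ψ₁ t - 2 * Real.pi * k₁)) (k₂ - k₁) (by push_cast; ring)]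
    · intro t
      have e := ((h2 t).sub_const (2 * Real.pi * k₂)).sub_const Real.pi
      refine e.congr_deriv ?_
      simp only [wcA]
      rw [← mul_assoc, hσσ, one_mul]
      rw [qper (ψ₂ t) (Real.pi + (ψ₂ t - 2 * Real.pi * k₂ - Real.pi)) k₂ (by ring),
        gper (ψ₁ t - ψ₃ t) (ψ₁ t - 2 * Real.pi * k₁ - ψ₃ t) k₁ (by ring),
        gper (-ψ₂ t - ψ₃ t) (-(Real.pi + (ψ₂ t - 2 * Real.pi * k₂ - Real.pi)) - ψ₃ t) (-k₂)
          (by push_cast; ring),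
        gper (ψ₁ t - ψ₂ t - ψ₃ t) (ψ₁ t - 2 * Real.pi * k₁ -
          (Real.pi + (ψ₂ t - 2 * Real.pi * k₂ - Real.pi)) - ψ₃ t) (k₁ - k₂) (by push_cast; ring)]
    · intro t
      have e := (h3 t).const_mul σ
      refine e.congr_deriv ?_
      simp only [wch]
      rw [← mul_assoc, hσσ, one_mul]
      rw [gper (ψ₁ t) (ψ₁ t - 2 * Real.pi * k₁) k₁ (by ring),
        gper (ψ₂ t) (Real.pi + (ψ₂ t - 2 * Real.pi * k₂ - Real.pi)) k₂ (by ring),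
        gper (ψ₃ t + ψ₂ t) (ψ₃ t + (Real.pi + (ψ₂ t - 2 * Real.pi * k₂ - Real.pi))) k₂ (by ring),
        gper (ψ₁ t - ψ₃ t) (ψ₁ t - 2 * Real.pi * k₁ - ψ₃ t) k₁ (by ring)]
    · rw [zero_add] at p1
      exact p1.le.trans hδ'
    · obtain ⟨j, hj⟩ : ∃ j : ℤ, σ = j := by
        rcases hσ with h | h
        · exact ⟨1, by simp [h]⟩
        · exact ⟨-1, by simp [h]⟩
      have b1 := hvl (S s0 + 2 * Real.pi * ((j * k₃ : ℤ) : ℝ)) (σ * ψ₃ 0)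
      rw [hvpk] at b1
      have b2 : |S s0 + 2 * Real.pi * ((j * k₃ : ℤ) : ℝ) - σ * ψ₃ 0|
          = |ψ₃ 0 - (σ * S s0 + 2 * Real.pi * k₃)| := by
        have : S s0 + 2 * Real.pi * ((j * k₃ : ℤ) : ℝ) - σ * ψ₃ 0
          = -σ * (ψ₃ 0 - (σ * S s0 + 2 * Real.pi * k₃)) := by
          push_cast
          rw [← hj]
          linear_combination (-S s0) * hσσ
        rw [this, abs_mul, abs_neg, hσa, one_mul]
      rw [b2] at b1
      have hMm : 0 < M / m := by positivity
      have b3 := mul_le_mul_of_nonneg_left p3.le hMm.le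
      have b4 : δ / (1 + M / m) + M / m * (δ / (1 + M / m)) = δ := by
        have : 1 + M / m ≠ 0 := by positivity
        rw [← one_add_mul, mul_div_cancel₀ _ this]
      have e : ψ₂ 0 - 2 * Real.pi * k₂ - Real.pi - v (σ * ψ₃ 0)
        = (ψ₂ 0 - (Real.pi + v (S s0) + 2 * Real.pi * k₂)) + (v (S s0) - v (σ * ψ₃ 0)) := by ring
      show |ψ₂ 0 - 2 * Real.pi * k₂ - Real.pi - v (σ * ψ₃ 0)| ≤ δ
      rw [e]
      refine (abs_add_le _ _).trans ?_
      linarith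
  · refine ⟨Real.pi + η / 2, fun t => ⟨?_, ?_⟩⟩
    · rw [abs_zero]; positivity
    · refine (abs_add_le _ _).trans ?_
      rw [abs_of_pos Real.pi_pos]
      linarith [hvb (S t)]
  · exact wc_avg _ T _ hT (by fun_prop) (fun t => by rw [hSp]; ring)
  · have : σ ≠ 0 := by rcases hσ with h | h <;> simp [h]
    have := Real.pi_ne_zero
    positivity
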